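/- Let V, r, par be a finite rooted tree, let a be an integer weight function on it, and fix marked nodes M ⊆ V and guesses g : V → ℤ satisfying conditions (i)–(iii) of a well-spread guess assignment. If no node of V is heavy, then |M| ≤ a(r). -/

import Mathlib

open scoped Classical

theorem sInf_iterate_eq_succ_of_ne {V : Type*} {r : V} {par : V → V}
    (htree : ∀ v : V, ∃ k : ℕ, par^[k] v = r) {u : V} (hu : u ≠ r) :
    sInf {k : ℕ | par^[k] u = r} = sInf {k : ℕ | par^[k] (par u) = r} + 1 := by
  refine (Nat.sInf_def (s := {k | par^[k] u = r}) (htree u)).trans ?_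
  rw [Nat.sInf_def (s := {k | par^[k] (par u) = r}) (htree (par u))]
  exact Nat.find_comp_succ (htree u) (htree (par u)) hu

theorem exists_child_of_iterate_eq {V : Type*} {r : V} {par : V → V} (hroot : par r = r)
    {x v : V} (h : ∃ k : ℕ, par^[k] x = v) :
    x = v ∨ ∃ u, (u ≠ r ∧ par u = v) ∧ ∃ k : ℕ, par^[k] x = u := by
  obtain ⟨k, hk⟩ := h
  induction k with
  | zero => exact Or.inl hk
  | succ k ih =>
    rw [Function.iterate_succ_apply'] at hk
    by_cases hr : par^[k] x = r
    · exact ih (by rw [hr, ← hk, hr, hroot])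
    · exact Or.inr ⟨_, ⟨hr, hk⟩, k, rfl⟩

theorem card_marked_descendants_le {V : Type*} [Fintype V] {r : V} {par : V → V}
    (hroot : par r = r) (M : Finset V) (v : V) :
    (M.filter (fun x => ∃ k : ℕ, par^[k] x = v)).card ≤
      (if v ∈ M then 1 else 0) +
        ∑ u ∈ Finset.univ.filter (fun u => u ≠ r ∧ par u = v),
          (M.filter (fun x => ∃ k : ℕ, par^[k] x = u)).card := by
  have hsub : M.filter (fun x => ∃ k : ℕ, par^[k] x = v) ⊆
      (if v ∈ M then {v} else ∅) ∪
        (Finset.univ.filter (fun u => u ≠ r ∧ par u = v)).biUnion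
          (fun u => M.filter (fun x => ∃ k : ℕ, par^[k] x = u)) := by
    intro x hx
    obtain ⟨hxM, hx⟩ := Finset.mem_filter.1 hx
    rcases exists_child_of_iterate_eq hroot hx with rfl | ⟨u, hu, hxu⟩
    · simp [hxM]
    · refine Finset.mem_union_right _ (Finset.mem_biUnion.2 ⟨u, ?_, ?_⟩)
      · exact Finset.mem_filter.2 ⟨Finset.mem_univ u, hu⟩
      · exact Finset.mem_filter.2 ⟨hxM, hxu⟩
  refine (Finset.card_le_card hsub).trans ((Finset.card_union_le _ _).trans ?_)
  refine Nat.add_le_add (le_of_eq ?_) Finset.card_biUnion_le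
  split_ifs <;> simp

/-- A finite sum of integers, each at least `1` except at most one, which is at least `0`,
is positive as soon as there are two of them. -/
theorem one_le_sum_of_subsingleton_exception {V : Type*} {s t : Finset V} {f : V → ℤ}
    (hs : s.Nontrivial) (ht : ∀ u ∈ s, u ∈ t → ∀ v ∈ s, v ∈ t → u = v)
    (hf : ∀ u ∈ s, 1 ≤ f u + (if u ∈ t then 1 else 0)) : 1 ≤ ∑ u ∈ s, f u := by
  have hnn : ∀ u ∈ s, 0 ≤ f u := fun u hu => by
    have := hf u hu
    split_ifs at this <;> omega
  obtain ⟨x, hx, y, hy, hxy⟩ := hs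
  obtain ⟨z, hz, hzt⟩ : ∃ z ∈ s, z ∉ t := by
    by_contra! h
    exact hxy (ht x hx (h x hx) y hy (h y hy))
  have h1 : 1 ≤ f z := by simpa [hzt] using hf z hz
  exact h1.trans (Finset.single_le_sum hnn hz)

/-- Lemma C.4 (xl:bound1): in a well-spread assignment of guesses with no heavy node,
the number of marked (guessed) nodes is at most the weight of the root. -/
theorem card_marked_le_of_no_heavy
    {V : Type*} [Fintype V]
    (r : V) (par : V → V) (hroot : par r = r)
    (htree : ∀ v : V, ∃ k : ℕ, par^[k] v = r)
    (a : V → ℤ)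
    (ha : ∀ v, 1 ≤ a v)
    (hsum : ∀ v : V,
      (∑ u ∈ Finset.univ.filter (fun u => u ≠ r ∧ par u = v), a u) ≤ a v)
    (M : Finset V) (g : V → ℤ)
    -- (i) guesses never underestimate
    (hge : ∀ v ∈ M, a v ≤ g v)
    -- (ii) guesses are exact on only children
    (honly : ∀ v ∈ M, v ≠ r → (∀ u : V, u ≠ r → par u = par v → u = v) → g v = a v)
    -- (iii) well-spread: distinct marked nodes have distinct depths
    (hspread : ∀ u ∈ M, ∀ v ∈ M,
      sInf {k : ℕ | par^[k] u = r} = sInf {k : ℕ | par^[k] v = r} → u = v)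
    -- no node is heavy
    (hnone : ∀ v ∈ M,
      ¬ (g v ≤ ((M.filter (fun u => ∃ k : ℕ, par^[k] u = v)).card : ℤ))) :
    (M.card : ℤ) ≤ a r := by
  set depth : V → ℕ := fun v => sInf {k : ℕ | par^[k] v = r} with hdepth
  set w : V → ℕ := fun v => (M.filter (fun x => ∃ k : ℕ, par^[k] x = v)).card with hw
  have hsucc : ∀ u, u ≠ r → depth u = depth (par u) + 1 := fun u hu =>
    sInf_iterate_eq_succ_of_ne htree hu
  have key : ∀ v, 1 ≤ a v - w v + (if v ∈ M then 1 else 0) := by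
    intro v
    induction hn : Finset.univ.sup depth - depth v using Nat.strong_induction_on
      generalizing v with
    | _ n ih =>
    set C := Finset.univ.filter (fun u => u ≠ r ∧ par u = v) with hC
    have hmem : ∀ u, u ∈ C ↔ u ≠ r ∧ par u = v := fun u => by simp [hC]
    have hchild : ∀ u ∈ C, 1 ≤ a u - w u + (if u ∈ M then 1 else 0) := by
      intro u hu
      obtain ⟨hur, hpar⟩ := (hmem u).1 hu
      have h1 := hsucc u hur
      have h2 : depth u ≤ Finset.univ.sup depth := Finset.le_sup (Finset.mem_univ u)
      rw [hpar] at h1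
      exact ih _ (by omega) u rfl
    have hwv : (w v : ℤ) ≤ (if v ∈ M then 1 else 0) + ∑ u ∈ C, (w u : ℤ) := by
      exact_mod_cast card_marked_descendants_le hroot M v
    have hav : ∑ u ∈ C, a u ≤ a v := hsum v
    rcases C.eq_empty_or_nonempty with hempty | hne
    · rw [hempty, Finset.sum_empty] at hwv
      have := ha v
      omega
    suffices h : 1 ≤ ∑ u ∈ C, (a u - w u) by
      rw [Finset.sum_sub_distrib] at h
      omega
    rcases hne.exists_eq_singleton_or_nontrivial with ⟨u, hu⟩ | hnt
    · rw [hu, Finset.sum_singleton]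
      have huC : u ∈ C := by simp [hu]
      obtain ⟨hur, hpar⟩ := (hmem u).1 huC
      by_cases huM : u ∈ M
      · have hg := honly u huM hur fun x hx hxp => by
          have : x ∈ C := (hmem x).2 ⟨hx, hxp.trans hpar⟩
          simpa [hu] using this
        have hlt : ¬ g u ≤ (w u : ℤ) := hnone u huM
        omega
      · simpa [huM] using hchild u huC
    · refine one_le_sum_of_subsingleton_exception hnt (fun x hx hxM y hy hyM => ?_) hchild
      obtain ⟨hxr, hxp⟩ := (hmem x).1 hx
      obtain ⟨hyr, hyp⟩ := (hmem y).1 hy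
      refine hspread x hxM y hyM ?_
      change depth x = depth y
      rw [hsucc x hxr, hsucc y hyr, hxp, hyp]
  have hwr : w r = M.card := congrArg Finset.card (Finset.filter_true_of_mem fun x _ => htree x)
  have := key r
  rw [hwr] at this
  split_ifs at this <;> omega
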